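/- For every integer n ≥ 0, all integers j, k ≥ 0 with j + k ≤ n, and every (x,y,z) ∈ B₃: x·Q_n^{j,k}(x,y,z) = a^{[n]}_{j,k}·Q_{n+1}^{j,k}(x,y,z) + a^{[n−1]}_{j,k}·Q_{n−1}^{j,k}(x,y,z), where a^{[m]}_{j,k} = (1/2)·√((j+k+m+3)(m+1−j−k)/((m+5/2)(m+3/2))), and the second term on the right-hand side is taken to be 0 when j + k = n. -/

import Mathlib

open MeasureTheory Real Filter

/-- The Gegenbauer polynomials `C_n^λ`, defined by their triple recursion. -/
noncomputable def gegenbauer (lam : ℝ) : ℕ → ℝ → ℝ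
  | 0, _ => 1
  | 1, t => 2 * lam * t
  | (n + 2), t =>
      (2 * (((n : ℝ) + 1) + lam) / ((n : ℝ) + 2)) * t * gegenbauer lam (n + 1) t
        - ((((n : ℝ) + 1) + 2 * lam - 1) / ((n : ℝ) + 2)) * gegenbauer lam n t

/-- The open unit ball in `ℝ³`. -/
def unitBall3 : Set (ℝ × ℝ × ℝ) := {p | p.1 ^ 2 + p.2.1 ^ 2 + p.2.2 ^ 2 < 1}

/-- `(N_m^{[μ]})²`, the squared weighted `L²`-norm of the Gegenbauer
polynomial `C_m^μ`. -/
noncomputable def Nsq (mu : ℝ) (m : ℕ) : ℝ :=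
  π * Real.Gamma (2 * mu + m) /
    ((2 : ℝ) ^ (2 * mu - 1) * (Nat.factorial m : ℝ) * (mu + m) * Real.Gamma mu ^ 2)

/-- The normalization constant `h_{j,k,n}`. -/
noncomputable def h3 (j k n : ℕ) : ℝ :=
  Real.sqrt (Nsq (1 / 2) k * Nsq ((k : ℝ) + 1) j *
    Nsq ((j : ℝ) + (k : ℝ) + 3 / 2) (n - j - k))

/-- The orthonormal polynomial basis `Q_n^{j,k}` on the unit ball. -/
noncomputable def Q3 (n j k : ℕ) (x y z : ℝ) : ℝ :=
  (1 / h3 j k n) * gegenbauer ((j : ℝ) + (k : ℝ) + 3 / 2) (n - j - k) x *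
    (1 - x ^ 2) ^ ((j : ℝ) / 2) * gegenbauer ((k : ℝ) + 1) j (y / Real.sqrt (1 - x ^ 2)) *
    (1 - x ^ 2 - y ^ 2) ^ ((k : ℝ) / 2) *
    gegenbauer (1 / 2) k (z / Real.sqrt (1 - x ^ 2 - y ^ 2))

/-- The recursion coefficient `a^{[m]}_{j,k}` for the `x`-direction relation. -/
noncomputable def a3 (j k m : ℤ) : ℝ :=
  (1 / 2) * Real.sqrt (((j : ℝ) + k + m + 3) * ((m : ℝ) + 1 - j - k) /
    (((m : ℝ) + 5 / 2) * ((m : ℝ) + 3 / 2)))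

theorem Nsq_pos {mu : ℝ} (hmu : 0 < mu) (m : ℕ) : 0 < Nsq mu m := by
  have h1 : 0 < Real.Gamma (2 * mu + m) := Real.Gamma_pos_of_pos (by positivity)
  have h2 : 0 < Real.Gamma mu := Real.Gamma_pos_of_pos hmu
  unfold Nsq
  positivity

/-- The ratio of consecutive squared norms of Gegenbauer polynomials. -/
theorem Nsq_succ {mu : ℝ} (hmu : 0 < mu) (m : ℕ) :
    Nsq mu (m + 1) = (2 * mu + m) * (mu + m) / ((m + 1) * (mu + m + 1)) * Nsq mu m := by
  have h2 : 0 < Real.Gamma mu := Real.Gamma_pos_of_pos hmu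
  have hstep : Real.Gamma (2 * mu + (m + 1 : ℕ)) = (2 * mu + m) * Real.Gamma (2 * mu + m) := by
    rw [← Real.Gamma_add_one (by positivity)]
    push_cast
    ring_nf
  unfold Nsq
  rw [hstep, Nat.factorial_succ]
  push_cast
  rw [← add_assoc]
  field_simp

theorem h3_add_pos (j k m : ℕ) : 0 < h3 j k (j + k + m) :=
  Real.sqrt_pos.2 (mul_pos (mul_pos (Nsq_pos (by norm_num) _) (Nsq_pos (by positivity) _))
    (Nsq_pos (by positivity) _))

theorem h3_sq_add_succ (j k m : ℕ) :
    h3 j k (j + k + (m + 1)) ^ 2 =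
      (2 * j + 2 * k + m + 3) * (j + k + m + 3 / 2) / ((m + 1) * (j + k + m + 5 / 2)) *
        h3 j k (j + k + m) ^ 2 := by
  have e (p : ℕ) : j + k + p - j - k = p := by omega
  have hN (p : ℕ) : 0 < Nsq ((j : ℝ) + k + 3 / 2) p := Nsq_pos (by positivity) p
  have hk : 0 < Nsq (1 / 2) k := Nsq_pos (by norm_num) k
  have hj : 0 < Nsq ((k : ℝ) + 1) j := Nsq_pos (by positivity) j
  unfold h3
  rw [e, e, Real.sq_sqrt (by have := hN (m + 1); positivity),
    Real.sq_sqrt (by have := hN m; positivity), Nsq_succ (by positivity)]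
  field_simp
  ring

theorem a3_nonneg (j k m : ℤ) : 0 ≤ a3 j k m := by
  unfold a3
  positivity

theorem a3_sq_add (j k m : ℕ) :
    a3 j k ((j + k + m : ℕ) : ℤ) ^ 2 =
      (2 * j + 2 * k + m + 3) * (m + 1) / (4 * (j + k + m + 5 / 2) * (j + k + m + 3 / 2)) := by
  have e : (j + k + m + 1 - j - k : ℝ) = m + 1 := by ring
  unfold a3
  push_cast
  rw [e, mul_pow, Real.sq_sqrt (by positivity)]
  field_simp
  ring

theorem a3_mul_h3_add (j k m : ℕ) :
    a3 j k ((j + k + m : ℕ) : ℤ) * h3 j k (j + k + m) =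
      (m + 1) / (2 * (j + k + m + 3 / 2)) * h3 j k (j + k + (m + 1)) := by
  have h0 := h3_add_pos j k m
  have h1 := h3_add_pos j k (m + 1)
  have ha := a3_nonneg j k ((j + k + m : ℕ) : ℤ)
  refine (pow_left_inj₀ (by positivity) (by positivity) two_ne_zero).1 ?_
  rw [mul_pow, mul_pow, a3_sq_add, h3_sq_add_succ]
  field_simp
  ring

theorem a3_mul_h3_add_succ (j k m : ℕ) :
    a3 j k ((j + k + m : ℕ) : ℤ) * h3 j k (j + k + (m + 1)) =
      (2 * j + 2 * k + m + 3) / (2 * (j + k + m + 5 / 2)) * h3 j k (j + k + m) := by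
  have h0 := h3_add_pos j k m
  have h1 := h3_add_pos j k (m + 1)
  have ha := a3_nonneg j k ((j + k + m : ℕ) : ℤ)
  refine (pow_left_inj₀ (by positivity) (by positivity) two_ne_zero).1 ?_
  rw [mul_pow, mul_pow, a3_sq_add, h3_sq_add_succ]
  field_simp
  ring

theorem a3_div_h3_add_succ (j k m : ℕ) :
    a3 j k ((j + k + m : ℕ) : ℤ) * (1 / h3 j k (j + k + (m + 1))) =
      (m + 1) / (2 * (j + k + m + 3 / 2)) * (1 / h3 j k (j + k + m)) := by
  have h0 := h3_add_pos j k m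
  have h1 := h3_add_pos j k (m + 1)
  rw [mul_one_div, mul_one_div, div_eq_div_iff h1.ne' h0.ne', a3_mul_h3_add]

theorem a3_div_h3_add (j k m : ℕ) :
    a3 j k ((j + k + m : ℕ) : ℤ) * (1 / h3 j k (j + k + m)) =
      (2 * j + 2 * k + m + 3) / (2 * (j + k + m + 5 / 2)) *
        (1 / h3 j k (j + k + (m + 1))) := by
  have h0 := h3_add_pos j k m
  have h1 := h3_add_pos j k (m + 1)
  rw [mul_one_div, mul_one_div, div_eq_div_iff h0.ne' h1.ne', a3_mul_h3_add_succ]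

/-- The factor of `Q3` that does not depend on the total degree. -/
noncomputable def angularFactor (j k : ℕ) (x y z : ℝ) : ℝ :=
  (1 - x ^ 2) ^ ((j : ℝ) / 2) * gegenbauer ((k : ℝ) + 1) j (y / Real.sqrt (1 - x ^ 2)) *
    (1 - x ^ 2 - y ^ 2) ^ ((k : ℝ) / 2) *
    gegenbauer (1 / 2) k (z / Real.sqrt (1 - x ^ 2 - y ^ 2))

theorem Q3_add (j k m : ℕ) (x y z : ℝ) :
    Q3 (j + k + m) j k x y z =
      1 / h3 j k (j + k + m) * gegenbauer ((j : ℝ) + k + 3 / 2) m x *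
        angularFactor j k x y z := by
  have e : j + k + m - j - k = m := by omega
  unfold Q3 angularFactor
  rw [e]
  ring

/-- the `x`-direction triple recursion relation for the `Q_n^{j,k}`. -/
theorem Q3_recursion_x (n j k : ℕ) (hjk : j + k ≤ n) (x y z : ℝ)
    (hxyz : (x, y, z) ∈ unitBall3) :
    x * Q3 n j k x y z =
      a3 j k n * Q3 (n + 1) j k x y z +
        (if j + k = n then 0 else
          a3 (j : ℤ) (k : ℤ) ((n : ℤ) - 1) * Q3 (n - 1) j k x y z) := by
  obtain ⟨m, rfl⟩ := Nat.exists_eq_add_of_le hjk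
  have hup := a3_div_h3_add_succ j k m
  rw [add_assoc (j + k) m 1, Q3_add, Q3_add, ← mul_assoc (a3 _ _ _), ← mul_assoc (a3 _ _ _), hup]
  cases m with
  | zero =>
    simp only [Nat.cast_zero, gegenbauer, add_zero, if_true]
    field_simp
    ring
  | succ p =>
    have hdown := a3_div_h3_add j k p
    have e1 : ((j + k + (p + 1) : ℕ) : ℤ) - 1 = ((j + k + p : ℕ) : ℤ) := by push_cast; ring
    have e2 : j + k + (p + 1) - 1 = j + k + p := by omega
    rw [if_neg (by omega), e1, e2, Q3_add, ← mul_assoc (a3 _ _ _), ← mul_assoc (a3 _ _ _), hdown]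
    simp only [gegenbauer]
    push_cast
    have d1 : (j + k + (p + 1) + 3 / 2 : ℝ) ≠ 0 := by positivity
    have d2 : (j + k + p + 5 / 2 : ℝ) = j + k + (p + 1) + 3 / 2 := by ring
    have d3 : (p + 1 + 1 : ℝ) = p + 2 := by ring
    rw [d2, d3]
    field_simp
    ring
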